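/- arXiv:1510.04712 — 3 statements merged into one kernel-verified Lean document; each statement's English description precedes it below -/
import Mathlib

section
/- In the DCS setting with 1 ≤ p ≤ m, the following are equivalent: (i) for every set F ⊆ X with 1 ≤ |F| ≤ p, the attacked graph G^a_F contains a |F|-linking from the input vertices to Y; (ii) for every unobserved agent x ∈ X, every vertex separator of (x, o) in the collapsed graph G″ has cardinality at least p. -/
/-- A walk from `a` to `b` along the edge relation `E`, recorded as its list of vertices. -/
def IsWalk {V : Type*} (E : V → V → Prop) (a b : V) (P : List V) : Prop :=
  P.Chain' E ∧ P.head? = some a ∧ P.getLast? = some b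

/-- `S` is a vertex separator of the pair `(a, b)`: `a, b ∉ S` and every
path from `a` to `b` meets `S`. -/
def IsSeparator {V : Type*} (E : V → V → Prop) (a b : V) (S : Set V) : Prop :=
  a ∉ S ∧ b ∉ S ∧ ∀ P : List V, IsWalk E a b P → ∃ s ∈ S, s ∈ P

/-- A `q`-linking from `A` to `B`: `q` pairwise vertex-disjoint simple paths,
each starting in `A` and ending in `B`. -/
def HasLinking {V : Type*} (E : V → V → Prop) (A B : Set V) (q : ℕ) : Prop :=
  ∃ P : Fin q → List V,
    (∀ i, (P i).Nodup ∧ ∃ a ∈ A, ∃ b ∈ B, IsWalk E a b (P i)) ∧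
    ∀ i j, i ≠ j → ∀ v, v ∈ P i → v ∉ P j

/-- `q` internally disjoint simple paths from `a` to `b`. -/
def HasInternallyDisjoint {V : Type*} (E : V → V → Prop) (a b : V) (q : ℕ) : Prop :=
  ∃ P : Fin q → List V,
    (∀ i, (P i).Nodup ∧ IsWalk E a b (P i)) ∧
    ∀ i j, i ≠ j → ∀ v, v ∈ P i → v ∈ P j → v = a ∨ v = b

/-- A DCS digraph on `n` agents (`Sum.inl`) and `m` observers (`Sum.inr`):
every agent has a self-loop, each observer has exactly one incoming edge, which comes
from its (dedicated) agent `obs j`, distinct observers observe distinct agents, and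
observers have no outgoing edges. -/
structure DCS (n m : ℕ) where
  E : (Fin n ⊕ Fin m) → (Fin n ⊕ Fin m) → Prop
  obs : Fin m → Fin n
  obs_inj : Function.Injective obs
  selfLoop : ∀ i : Fin n, E (Sum.inl i) (Sum.inl i)
  obs_in : ∀ (j : Fin m) (i : Fin n), E (Sum.inl i) (Sum.inr j) ↔ i = obs j
  obs_noOut : ∀ (j : Fin m) (v : Fin n ⊕ Fin m), ¬ E (Sum.inr j) v

/-- Agent `x` is measured by some observer. -/
def Observed {n m : ℕ} (G : DCS n m) (x : Fin n) : Prop := ∃ j, G.obs j = x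

/-- The augmented graph `G′`: a new vertex `o = Sum.inr ()` is added, with an
edge from every observer to `o`. -/
def augE {n m : ℕ} (G : DCS n m) :
    ((Fin n ⊕ Fin m) ⊕ Unit) → ((Fin n ⊕ Fin m) ⊕ Unit) → Prop
  | Sum.inl a, Sum.inl b => G.E a b
  | Sum.inl (Sum.inr _), Sum.inr _ => True
  | _, _ => False

/-- The collapsed graph `G″`: observers are deleted, a new vertex `o = Sum.inr ()`
is added, and every observed agent gets an edge to `o`. -/
def colE {n m : ℕ} (G : DCS n m) :
    (Fin n ⊕ Unit) → (Fin n ⊕ Unit) → Prop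
  | Sum.inl a, Sum.inl b => G.E (Sum.inl a) (Sum.inl b)
  | Sum.inl a, Sum.inr _ => ∃ j, G.obs j = a
  | _, _ => False

/-- The attacked graph `G^a_F`: one new (dedicated) input vertex for each element
of `F`, with a single edge from that input vertex to its element of `F`. -/
def atkE {V : Type*} (E : V → V → Prop) (F : Set V) :
    (V ⊕ ↥F) → (V ⊕ ↥F) → Prop
  | Sum.inl a, Sum.inl b => E a b
  | Sum.inr u, Sum.inl b => (u : V) = b
  | _, _ => False

/-- The number of agent-to-agent edges (self-loops included), i.e. `‖A‖₀`. -/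
noncomputable def agentEdgeCount {n m : ℕ} (G : DCS n m) : ℕ :=
  {e : Fin n × Fin n | G.E (Sum.inl e.1) (Sum.inl e.2)}.ncard

/-- Robustness to attacks on agents and sensors: every vertex separator of any
`(x, o)` in the augmented graph `G′` has cardinality at least `p`. -/
def RobustXY {n m : ℕ} (G : DCS n m) (p : ℕ) : Prop :=
  ∀ (x : Fin n) (S : Set ((Fin n ⊕ Fin m) ⊕ Unit)),
    IsSeparator (augE G) (Sum.inl (Sum.inl x)) (Sum.inr ()) S → p ≤ S.ncard

/-- Robustness to agent-only attacks: for every unobserved agent `x`, every vertex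
separator of `(x, o)` in the collapsed graph `G″` has cardinality at least `p`. -/
def RobustX {n m : ℕ} (G : DCS n m) (p : ℕ) : Prop :=
  ∀ x : Fin n, ¬ Observed G x → ∀ S : Set (Fin n ⊕ Unit),
    IsSeparator (colE G) (Sum.inl x) (Sum.inr ()) S → p ≤ S.ncard

theorem IsWalk.reflTransGen {V : Type*} {E : V → V → Prop} {a b : V} {P : List V}
    (h : IsWalk E a b P) {v : V} (hv : v ∈ P) :
    Relation.ReflTransGen (fun u w => E u w ∧ w ∈ P) a v := by
  obtain ⟨hc, hh, -⟩ := h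
  induction P generalizing a with
  | nil => simp at hv
  | cons c P ih =>
    obtain rfl : c = a := by simpa using hh
    rcases List.mem_cons.1 hv with rfl | hv
    · exact .refl
    cases P with
    | nil => simp at hv
    | cons d P =>
      obtain ⟨hcd, hc⟩ := List.isChain_cons_cons.1 hc
      refine .head ⟨hcd, by simp⟩ ?_
      exact (ih hv hc rfl).lift id fun u w h => ⟨h.1, List.mem_cons_of_mem _ h.2⟩

theorem exists_nodup_isWalk {V : Type*} {E : V → V → Prop} {a b : V}
    (h : Relation.ReflTransGen E a b) : ∃ P : List V, P.Nodup ∧ IsWalk E a b P := by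
  induction h using Relation.ReflTransGen.head_induction_on with
  | refl => exact ⟨[b], by simp, List.isChain_singleton _, rfl, rfl⟩
  | @head a c hac _ ih =>
    obtain ⟨P, hn, hc, hh, hl⟩ := ih
    by_cases ha : a ∈ P
    · obtain ⟨s, t, rfl⟩ := List.append_of_mem ha
      refine ⟨a :: t, hn.of_append_right, (List.isChain_append.1 hc).2.1, rfl, ?_⟩
      simpa using hl
    · cases P with
      | nil => simp at hh
      | cons d P =>
        obtain rfl : d = c := by simpa using hh
        exact ⟨a :: d :: P, List.nodup_cons.2 ⟨ha, hn⟩, List.isChain_cons_cons.2 ⟨hac, hc⟩, rfl,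
          by simpa using hl⟩

theorem IsSeparator.not_reflTransGen {V : Type*} {E : V → V → Prop} {a b : V} {S : Set V}
    (h : IsSeparator E a b S) : ¬ Relation.ReflTransGen (fun u w => E u w ∧ w ∉ S) a b := by
  intro hr
  obtain ⟨P, -, hP⟩ := exists_nodup_isWalk hr
  obtain ⟨s, hs, hsP⟩ := h.2.2 P ⟨hP.1.imp fun _ _ h => h.1, hP.2⟩
  rcases Relation.ReflTransGen.cases_tail (hP.reflTransGen hsP) with rfl | ⟨_, -, h1, -⟩
  · exact h.1 hs
  · exact h1.2 hs

/-- If `E` is left-unique, two vertices without predecessors that reach a common vertex agree. -/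
theorem eq_of_reflTransGen_of_leftUnique {V : Type*} {E : V → V → Prop}
    (hE : Relator.LeftUnique E) {a b v : V} (ha : ∀ u, ¬ E u a) (hb : ∀ u, ¬ E u b)
    (hav : Relation.ReflTransGen E a v) (hbv : Relation.ReflTransGen E b v) : a = b := by
  induction hav with
  | refl => exact ((Relation.ReflTransGen.cases_tail hbv).resolve_right
      fun ⟨u, _, hu⟩ => ha u hu)
  | @tail u w _ huw ih =>
    rcases Relation.ReflTransGen.cases_tail hbv with rfl | ⟨u', hbu', hu'⟩
    · exact absurd huw (hb u)
    · exact ih (hE hu' huw ▸ hbu')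

/-- Following an injective successor function from a vertex outside its range, one leaves
the domain. -/
theorem exists_reflTransGen_inr {α β : Type*} [Finite α] {σ : α → α ⊕ β}
    (hσ : Function.Injective σ) {f : α} (hf : ∀ v, σ v ≠ Sum.inl f) :
    ∃ j : β, Relation.ReflTransGen (fun a b => ∃ v, a = Sum.inl v ∧ σ v = b)
      (Sum.inl f) (Sum.inr j) := by
  by_contra! hcon
  set R : α ⊕ β → α ⊕ β → Prop := fun a b => ∃ v, a = Sum.inl v ∧ σ v = b
  have key : ∀ a : {a : α // Relation.ReflTransGen R (.inl f) (.inl a)},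
      ∃ b : {a : α // Relation.ReflTransGen R (.inl f) (.inl a)}, σ a = .inl b := by
    rintro ⟨a, ha⟩
    have hr : Relation.ReflTransGen R (.inl f) (σ a) := ha.tail ⟨a, rfl, rfl⟩
    rcases hs : σ a with b | j
    · exact ⟨⟨b, hs ▸ hr⟩, rfl⟩
    · exact absurd (hs ▸ hr) (hcon j)
  choose g hg using key
  have hinj : Function.Injective g := fun a b hab =>
    Subtype.ext (hσ (by rw [hg, hg, hab]))
  obtain ⟨a, ha⟩ := Finite.surjective_of_injective hinj ⟨f, .refl⟩
  exact hf a (by rw [hg, ha])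

open Classical in
/-- If small separators do not exist, Hall's condition gives an injective choice of
out-neighbours for the agents that avoids `F`. -/
theorem exists_injective_successor {n m p : ℕ} (G : DCS n m) (hG : RobustX G p)
    (F : Set (Fin n)) (hFp : F.ncard ≤ p) :
    ∃ σ : Fin n → Fin n ⊕ Fin m, Function.Injective σ ∧
      ∀ v, G.E (Sum.inl v) (σ v) ∧ ∀ f ∈ F, σ v ≠ Sum.inl f := by
  let t : Fin n → Finset (Fin n ⊕ Fin m) := fun v =>
    Finset.univ.filter fun w => G.E (Sum.inl v) w ∧ ∀ f ∈ F, w ≠ Sum.inl f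
  suffices h : ∀ X : Finset (Fin n), X.card ≤ (X.biUnion t).card by
    obtain ⟨σ, hσ, hσt⟩ := (Finset.all_card_le_biUnion_card_iff_exists_injective t).1 h
    exact ⟨σ, hσ, fun v => by simpa [t] using hσt v⟩
  intro X
  by_contra! hX
  let D : Finset (Fin n) := Finset.univ.filter fun a =>
    a ∉ X ∧ a ∉ F ∧ ∃ v ∈ X, G.E (Sum.inl v) (Sum.inl a)
  let J : Finset (Fin m) := Finset.univ.filter fun j => G.obs j ∈ X
  let S : Finset (Fin n) := D ∪ J.image G.obs ∪ (F.toFinset \ X)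
  have hsub : ((X \ F.toFinset) ∪ D).disjSum J ⊆ X.biUnion t := by
    rintro (a | j) hw
    · simp only [Finset.inl_mem_disjSum, Finset.mem_union, Finset.mem_sdiff,
        Set.mem_toFinset, D, Finset.mem_filter, Finset.mem_univ, true_and] at hw
      simp only [Finset.mem_biUnion, t, Finset.mem_filter, Finset.mem_univ, true_and]
      rcases hw with ⟨haX, haF⟩ | ⟨-, haF, v, hv, hva⟩
      · exact ⟨a, haX, G.selfLoop a, fun f hf h => haF (Sum.inl_injective h ▸ hf)⟩
      · exact ⟨v, hv, hva, fun f hf h => haF (Sum.inl_injective h ▸ hf)⟩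
    · simp only [Finset.inr_mem_disjSum, J, Finset.mem_filter, Finset.mem_univ, true_and] at hw
      simp only [Finset.mem_biUnion, t, Finset.mem_filter, Finset.mem_univ, true_and]
      exact ⟨_, hw, (G.obs_in j _).2 rfl, fun f _ => by simp⟩
  have hdisj : Disjoint (X \ F.toFinset) D := by
    rw [Finset.disjoint_left]
    intro a ha haD
    exact (Finset.mem_filter.1 haD).2.1 (Finset.mem_sdiff.1 ha).1
  have hN := Finset.card_le_card hsub
  rw [Finset.card_disjSum, Finset.card_union_of_disjoint hdisj] at hN
  have hS : S.card < F.toFinset.card := by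
    have h1 : S.card ≤ D.card + J.card + (F.toFinset \ X).card :=
      (Finset.card_union_le _ _).trans (Nat.add_le_add_right
        ((Finset.card_union_le _ _).trans (Nat.add_le_add_left Finset.card_image_le _)) _)
    have h2 := Finset.card_sdiff_add_card_inter X F.toFinset
    have h3 := Finset.card_sdiff_add_card_inter F.toFinset X
    rw [Finset.inter_comm] at h3
    omega
  have hFc : F.ncard = F.toFinset.card := Set.ncard_eq_toFinset_card' F
  obtain ⟨f, hfF, hfS⟩ := Finset.exists_mem_notMem_of_card_lt_card hS
  have hfX : f ∈ X := by
    by_contra h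
    exact hfS (Finset.mem_union_right _ (Finset.mem_sdiff.2 ⟨hfF, h⟩))
  have hobs : ∀ a ∈ X, Observed G a → a ∈ S := by
    rintro _ ha ⟨j, rfl⟩
    exact Finset.mem_union_left _ (Finset.mem_union_right _
      (Finset.mem_image_of_mem _ (by simpa [J] using ha)))
  have hsep : IsSeparator (colE G) (Sum.inl f) (Sum.inr ()) (Sum.inl '' (S : Set (Fin n))) := by
    refine ⟨by simpa using hfS, by simp, fun P hP => ?_⟩
    by_contra! hcon
    have hinv : ∀ w, Relation.ReflTransGen (fun u w => colE G u w ∧ w ∈ P) (Sum.inl f) w →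
        ∃ a ∈ X, a ∉ S ∧ w = Sum.inl a := by
      intro w hw
      induction hw with
      | refl => exact ⟨f, hfX, hfS, rfl⟩
      | @tail u w _ huw ih =>
        obtain ⟨a, haX, haS, rfl⟩ := ih
        rcases w with b | _
        · have hbS : b ∉ S := fun h => hcon _ ⟨b, h, rfl⟩ huw.2
          refine ⟨b, ?_, hbS, rfl⟩
          by_contra hbX
          by_cases hbF : b ∈ F
          · exact hbS (Finset.mem_union_right _ (by simp [hbF, hbX]))
          · exact hbS (Finset.mem_union_left _ (Finset.mem_union_left _
              (Finset.mem_filter.2 ⟨Finset.mem_univ _, hbX, hbF, a, haX, huw.1⟩)))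
        · exact absurd (hobs a haX huw.1) haS
    obtain ⟨a, -, -, ha⟩ := hinv _ (hP.reflTransGen (List.mem_of_getLast? hP.2.2))
    simp at ha
  have hle := hG f (fun h => hfS (hobs f hfX h)) _ hsep
  rw [Set.ncard_image_of_injective _ Sum.inl_injective, Set.ncard_coe_finset] at hle
  omega

theorem hasLinking_of_injective_successor {n m : ℕ} (G : DCS n m) (F : Set (Fin n))
    {σ : Fin n → Fin n ⊕ Fin m} (hσ : Function.Injective σ)
    (hσE : ∀ v, G.E (Sum.inl v) (σ v) ∧ ∀ f ∈ F, σ v ≠ Sum.inl f) :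
    HasLinking (atkE G.E (Sum.inl '' F : Set (Fin n ⊕ Fin m)))
      {v | ∃ u, v = Sum.inr u} {v | ∃ j : Fin m, v = Sum.inl (Sum.inr j)} F.ncard := by
  set R : Fin n ⊕ Fin m → Fin n ⊕ Fin m → Prop := fun a b => ∃ v, a = Sum.inl v ∧ σ v = b
  have hRl : Relator.LeftUnique R := by
    rintro _ b _ ⟨v, rfl, rfl⟩ ⟨w, rfl, hw⟩
    rw [hσ hw]
  have hno : ∀ f ∈ F, ∀ u, ¬ R u (Sum.inl f) := by
    rintro f hf _ ⟨v, rfl, hv⟩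
    exact (hσE v).2 f hf hv
  have hpath : ∀ f : F, ∃ j : Fin m, ∃ P : List (Fin n ⊕ Fin m),
      P.Nodup ∧ IsWalk R (Sum.inl f) (Sum.inr j) P := fun f =>
    (exists_reflTransGen_inr hσ fun v => (hσE v).2 f f.2).imp fun _ h => exists_nodup_isWalk h
  choose j P hPn hPw using hpath
  have e : Fin F.ncard ≃ F := (Finite.equivFinOfCardEq (Nat.card_coe_set_eq F)).symm
  refine ⟨fun i => Sum.inr ⟨Sum.inl (e i), _, (e i).2, rfl⟩ :: (P (e i)).map Sum.inl,
    fun i => ⟨?_, _, ⟨_, rfl⟩, _, ⟨j (e i), rfl⟩, ?_, rfl, ?_⟩, ?_⟩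
  · exact List.nodup_cons.2 ⟨by simp, (hPn _).map Sum.inl_injective⟩
  · refine List.isChain_cons.2 ⟨fun y hy => ?_, ?_⟩
    · rw [List.head?_map, (hPw _).2.1] at hy
      obtain rfl : Sum.inl (Sum.inl (e i : Fin n)) = y := by simpa using hy
      rfl
    · refine List.isChain_map _ |>.2 ((hPw (e i)).1.imp ?_)
      rintro _ _ ⟨v, rfl, rfl⟩
      exact (hσE v).1
  · rw [List.getLast?_cons, List.getLast?_map, (hPw _).2.2]
    rfl
  · intro i k hik v hvi hvk
    have hne : (e i : Fin n) ≠ e k := fun h => hik (e.injective (Subtype.ext h))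
    rcases v with v | u
    · have hvi' : v ∈ P (e i) := by simpa using hvi
      have hvk' : v ∈ P (e k) := by simpa using hvk
      have := eq_of_reflTransGen_of_leftUnique hRl (hno _ (e i).2) (hno _ (e k).2)
        (((hPw _).reflTransGen hvi').lift id fun _ _ h => h.1)
        (((hPw _).reflTransGen hvk').lift id fun _ _ h => h.1)
      exact hne (Sum.inl_injective this)
    · have hui : u = ⟨Sum.inl (e i : Fin n), _, (e i).2, rfl⟩ := by simpa using hvi
      have huk : u = ⟨Sum.inl (e k : Fin n), _, (e k).2, rfl⟩ := by simpa using hvk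
      rw [hui] at huk
      exact hne (Sum.inl_injective (congrArg Subtype.val huk))

/-- In an attacked graph every walk from an input to an original vertex passes through
the attacked vertex. -/
theorem IsWalk.attacked_mem {V : Type*} {E : V → V → Prop} {F : Set V} {u : F} {b : V}
    {P : List (V ⊕ F)} (h : IsWalk (atkE E F) (Sum.inr u) (Sum.inl b) P) :
    Sum.inl (u : V) ∈ P := by
  rcases Relation.ReflTransGen.cases_head (h.reflTransGen (List.mem_of_getLast? h.2.2)) with
    h | ⟨c | c, ⟨hc, hcP⟩, -⟩
  · simp at h
  · exact (show (u : V) = c from hc) ▸ hcP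
  · exact hc.elim

/-- A linking from the agents in `S` together with `x` rules out that `S` separates `(x, o)`. -/
theorem not_isSeparator_of_hasLinking {n m : ℕ} (G : DCS n m) {x : Fin n} {S : Set (Fin n ⊕ Unit)}
    (hS : IsSeparator (colE G) (Sum.inl x) (Sum.inr ()) S) {F : Set (Fin n)}
    (hF : F = insert x (Sum.inl ⁻¹' S)) :
    ¬ HasLinking (atkE G.E (Sum.inl '' F : Set (Fin n ⊕ Fin m)))
      {v | ∃ u, v = Sum.inr u} {v | ∃ j : Fin m, v = Sum.inl (Sum.inr j)} F.ncard := by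
  rintro ⟨P, hP, hdisj⟩
  choose _ a ha b hb hw using hP
  choose u hu using ha
  choose j hj using hb
  obtain rfl : a = fun i => Sum.inr (u i) := funext hu
  obtain rfl : b = fun i => Sum.inl (Sum.inr (j i)) := funext hj
  have hinj : Function.Injective u := by
    intro i k hik
    by_contra hne
    refine hdisj i k hne _ (List.mem_of_head? (hw i).2.1) ?_
    simpa only [hik] using List.mem_of_head? (hw k).2.1
  have hcard : Nat.card (Fin F.ncard) = Nat.card (Sum.inl '' F : Set (Fin n ⊕ Fin m)) := by
    rw [Nat.card_fin, Nat.card_coe_set_eq, Set.ncard_image_of_injective _ Sum.inl_injective]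
  have hsurj : Function.Surjective u :=
    ((Nat.bijective_iff_injective_and_card u).2 ⟨hinj, hcard⟩).2
  obtain ⟨i, hi⟩ := hsurj ⟨Sum.inl x, x, by simp [hF], rfl⟩
  have havoid : ∀ s, Sum.inl (Sum.inl s) ∈ P i → Sum.inl s ∉ S := by
    intro s hsP hs
    obtain ⟨k, hk⟩ := hsurj ⟨Sum.inl s, s, by simp [hF, hs], rfl⟩
    have hik : i ≠ k := by
      rintro rfl
      have := Sum.inl_injective (congrArg Subtype.val (hi.symm.trans hk))
      exact hS.1 (this ▸ hs)
    have hsk := (hw k).attacked_mem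
    rw [hk] at hsk
    exact hdisj i k hik _ hsP hsk
  have hreach : ∀ w, Relation.ReflTransGen
      (fun u w => atkE G.E (Sum.inl '' F) u w ∧ w ∈ P i) (Sum.inr (u i)) w →
      match w with
      | Sum.inl (Sum.inl a) =>
        Relation.ReflTransGen (fun u w => colE G u w ∧ w ∉ S) (Sum.inl x) (Sum.inl a)
      | Sum.inl (Sum.inr _) =>
        Relation.ReflTransGen (fun u w => colE G u w ∧ w ∉ S) (Sum.inl x) (Sum.inr ())
      | Sum.inr v => v = u i := by
    intro w hw
    induction hw with
    | refl => rfl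
    | @tail v w _ hvw ih =>
      obtain ⟨hE, hmem⟩ := hvw
      rcases v with (v | v) | v
      · rcases w with (w | w) | w
        · exact ih.tail ⟨hE, havoid w hmem⟩
        · exact ih.tail ⟨⟨w, ((G.obs_in w v).1 hE).symm⟩, hS.2.1⟩
        · exact hE.elim
      · rcases w with w | w
        · exact (G.obs_noOut v w hE).elim
        · exact hE.elim
      · obtain rfl : v = u i := ih
        rcases w with w | w
        · obtain rfl : Sum.inl x = w := by
            have : (u i : Fin n ⊕ Fin m) = w := hE
            rwa [hi] at this
          exact .refl
        · exact hE.elim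
  exact hS.not_reflTransGen (hreach _ ((hw i).reflTransGen (List.mem_of_getLast? (hw i).2.2)))

/-- Vertex-separator characterization of structural left invertibility for all feasible
agent-only attacks: for `1 ≤ p ≤ m ≤ n`, every feasible attack set `F ⊆ X` with
`1 ≤ |F| ≤ p` admits an `|F|`-linking from the inputs to `Y` in the attacked graph iff
for every unobserved agent `x`, every vertex separator of `(x, o)` in the collapsed
graph `G″` has cardinality at least `p`. -/
theorem structural_left_invertibility_iff_separators_agentsOnly {n m p : ℕ}
    (hp : 1 ≤ p) (hpm : p ≤ m) (hmn : m ≤ n) (G : DCS n m) :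
    (∀ F : Set (Fin n), 1 ≤ F.ncard → F.ncard ≤ p →
      HasLinking (atkE G.E (Sum.inl '' F : Set (Fin n ⊕ Fin m)))
        {v : (Fin n ⊕ Fin m) ⊕ ↥(Sum.inl '' F : Set (Fin n ⊕ Fin m)) | ∃ u, v = Sum.inr u}
        {v : (Fin n ⊕ Fin m) ⊕ ↥(Sum.inl '' F : Set (Fin n ⊕ Fin m)) |
          ∃ j : Fin m, v = Sum.inl (Sum.inr j)}
        F.ncard) ↔
    (∀ x : Fin n, ¬ Observed G x → ∀ S : Set (Fin n ⊕ Unit),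
      IsSeparator (colE G) (Sum.inl x) (Sum.inr ()) S → p ≤ S.ncard) := by
  refine ⟨fun h x _ S hS => ?_, fun h F _ hFp => ?_⟩
  · by_contra! hlt
    have hx : x ∉ (Sum.inl ⁻¹' S : Set (Fin n)) := hS.1
    have hcard : (Sum.inl ⁻¹' S : Set (Fin n)).ncard ≤ S.ncard := by
      rw [← Set.ncard_image_of_injective _ (Sum.inl_injective (β := Unit))]
      exact Set.ncard_le_ncard (Set.image_preimage_subset _ _)
    have hF := Set.ncard_insert_of_notMem hx
    exact not_isSeparator_of_hasLinking G hS rfl (h _ (by omega) (by omega))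
  · obtain ⟨σ, hσ, hσE⟩ := exists_injective_successor G h F hFp
    exact hasLinking_of_injective_successor G F hσ hσE
end

section
/- In the DCS setting with 1 ≤ p ≤ m, suppose that for every agent x ∈ X, every vertex separator of (x, o) in the augmented graph G′ has cardinality at least p. Let F ⊆ X ∪ Y with |F| = p, and let G* be the digraph obtained from G′ by adding a new vertex u together with an edge from u to every element of F. Then every vertex separator of (u, o) in G* has cardinality at least p; equivalently, G* contains p internally disjoint simple paths from u to o. -/
/-- The graph `G*`: the augmented graph `G′` together with a new vertex `u = Sum.inr ()`
and an edge from `u` to every element of `F`. -/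
def starE {n m : ℕ} (G : DCS n m) (F : Set (Fin n ⊕ Fin m)) :
    (((Fin n ⊕ Fin m) ⊕ Unit) ⊕ Unit) → (((Fin n ⊕ Fin m) ⊕ Unit) ⊕ Unit) → Prop
  | Sum.inl a, Sum.inl b => augE G a b
  | Sum.inr _, Sum.inl (Sum.inl v) => v ∈ F
  | _, _ => False

theorem IsWalk.singleton {V : Type*} (E : V → V → Prop) (v : V) : IsWalk E v v [v] :=
  ⟨.singleton v, rfl, rfl⟩

theorem IsWalk.initial_segment {V : Type*} {E : V → V → Prop} {a b v : V} {l₁ l₂ : List V}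
    (h : IsWalk E a b (l₁ ++ v :: l₂)) : IsWalk E a v (l₁ ++ [v]) := by
  obtain ⟨hc, hh, -⟩ := h
  refine ⟨(List.isChain_split.1 hc).1, ?_, by simp⟩
  cases l₁ <;> simpa using hh

theorem IsWalk.final_segment {V : Type*} {E : V → V → Prop} {a b v : V} {l₁ l₂ : List V}
    (h : IsWalk E a b (l₁ ++ v :: l₂)) : IsWalk E v b (v :: l₂) := by
  obtain ⟨hc, -, hl⟩ := h
  exact ⟨(List.isChain_split.1 hc).2, by simp, by simpa [List.getLast?_append] using hl⟩

theorem IsWalk.glue {V : Type*} {E : V → V → Prop} {a b v : V} {l₁ l₂ : List V}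
    (h₁ : IsWalk E a v (l₁ ++ [v])) (h₂ : IsWalk E v b (v :: l₂)) :
    IsWalk E a b (l₁ ++ v :: l₂) := by
  refine ⟨List.isChain_split.2 ⟨h₁.1, h₂.1⟩, ?_, ?_⟩
  · have := h₁.2.1
    cases l₁ <;> simpa using this
  · simpa [List.getLast?_append] using h₂.2.2

theorem IsWalk.append {V : Type*} {E : V → V → Prop} {a b x y : V} {P Q : List V}
    (hP : IsWalk E a x P) (hQ : IsWalk E y b Q) (hxy : E x y) :
    IsWalk E a b (P ++ Q) := by
  obtain ⟨hc, hh, hl⟩ := hP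
  obtain ⟨hc', hh', hl'⟩ := hQ
  refine ⟨List.isChain_append.2 ⟨hc, hc', ?_⟩, ?_, ?_⟩
  · intro u hu w hw
    simp_all
  · simp [List.head?_append, hh]
  · simp [List.getLast?_append, hl']

theorem IsWalk.mono {V : Type*} {E E' : V → V → Prop} (hE : ∀ x y, E x y → E' x y)
    {a b : V} {P : List V} (h : IsWalk E a b P) : IsWalk E' a b P :=
  ⟨h.1.imp hE, h.2⟩

theorem HasLinking.mono {V : Type*} {E E' : V → V → Prop} (hE : ∀ x y, E x y → E' x y)
    {A B : Set V} {q : ℕ} (h : HasLinking E A B q) : HasLinking E' A B q := by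
  obtain ⟨P, hP, hd⟩ := h
  refine ⟨P, fun i => ⟨(hP i).1, ?_⟩, hd⟩
  obtain ⟨a, ha, b, hb, hw⟩ := (hP i).2
  exact ⟨a, ha, b, hb, hw.mono hE⟩

/-- `S` meets every walk from `A` to `B`. -/
def SeparatesSets {V : Type*} (E : V → V → Prop) (A B S : Set V) : Prop :=
  ∀ a ∈ A, ∀ b ∈ B, ∀ P : List V, IsWalk E a b P → ∃ s ∈ S, s ∈ P

/-- The relation `E` with the single edge `(x, y)` removed. -/
def EraseEdge {V : Type*} (E : V → V → Prop) (x y : V) (a b : V) : Prop :=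
  E a b ∧ ¬ (a = x ∧ b = y)

theorem isChain_eraseEdge_or {V : Type*} {E : V → V → Prop} {x y : V} {l : List V}
    (h : l.IsChain E) : l.IsChain (EraseEdge E x y) ∨ (x ∈ l ∧ y ∈ l) := by
  by_cases hm : x ∈ l ∧ y ∈ l
  · exact Or.inr hm
  · left
    induction h with
    | nil => exact .nil
    | singleton a => exact .singleton a
    | cons_cons hr _ ih =>
      refine .cons_cons ⟨hr, ?_⟩ (ih ?_)
      · rintro ⟨rfl, rfl⟩
        simp at hm
      · rintro ⟨h₁, h₂⟩
        exact hm ⟨List.mem_cons_of_mem _ h₁, List.mem_cons_of_mem _ h₂⟩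

theorem isChain_eraseEdge_of_notMem_init {V : Type*} {E : V → V → Prop} {x y s : V}
    {l : List V} (h : (l ++ [s]).IsChain E) (hx : x ∉ l) :
    (l ++ [s]).IsChain (EraseEdge E x y) := by
  induction l with
  | nil => simp
  | cons a l ih =>
    simp only [List.mem_cons, not_or] at hx
    rw [List.cons_append, List.isChain_cons] at h ⊢
    exact ⟨fun b hb => ⟨h.1 b hb, fun hab => hx.1 hab.1.symm⟩, ih h.2 hx.2⟩

theorem isChain_eraseEdge_of_notMem_tail {V : Type*} {E : V → V → Prop} {x y s : V}
    {l : List V} (h : (s :: l).IsChain E) (hy : y ∉ l) :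
    (s :: l).IsChain (EraseEdge E x y) := by
  induction l generalizing s with
  | nil => simp
  | cons a l ih =>
    simp only [List.mem_cons, not_or] at hy
    rw [List.isChain_cons_cons] at h ⊢
    exact ⟨⟨h.1, fun hab => hy.1 hab.2.symm⟩, ih h.2 hy.2⟩

theorem exists_first_mem {V : Type*} (S : Set V) {l : List V} (h : ∃ s ∈ S, s ∈ l) :
    ∃ s ∈ S, ∃ l₁ l₂, l = l₁ ++ s :: l₂ ∧ ∀ v ∈ l₁, v ∉ S := by
  induction l with
  | nil => simp at h
  | cons a l ih =>
    by_cases ha : a ∈ S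
    · exact ⟨a, ha, [], l, rfl, by simp⟩
    · obtain ⟨s, hs, hsl⟩ := h
      have hsl' : s ∈ l := by
        rcases List.mem_cons.1 hsl with rfl | h
        · exact absurd hs ha
        · exact h
      obtain ⟨t, ht, l₁, l₂, rfl, h₁⟩ := ih ⟨s, hs, hsl'⟩
      exact ⟨t, ht, a :: l₁, l₂, rfl, by simpa [ha] using h₁⟩

theorem exists_last_mem {V : Type*} (S : Set V) {l : List V} (h : ∃ s ∈ S, s ∈ l) :
    ∃ s ∈ S, ∃ l₁ l₂, l = l₁ ++ s :: l₂ ∧ ∀ v ∈ l₂, v ∉ S := by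
  obtain ⟨s, hs, l₁, l₂, hl, h₁⟩ := exists_first_mem S (l := l.reverse) (by simpa using h)
  refine ⟨s, hs, l₂.reverse, l₁.reverse, ?_, by simpa using h₁⟩
  simpa using congrArg List.reverse hl

/-- Disjoint paths with marked vertices filling a set of the same size can be indexed by
that set. -/
theorem exists_index_of_disjoint {V : Type*} [Finite V] {C : Set V} {q : ℕ}
    (hC : C.ncard = q) {P : Fin q → List V} (hd : ∀ i j, i ≠ j → ∀ v, v ∈ P i → v ∉ P j)
    {c : Fin q → V} (hc : ∀ i, c i ∈ C) (hmem : ∀ i, c i ∈ P i) :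
    ∃ α : V → List V, (∀ s ∈ C, ∃ i, c i = s ∧ α s = P i) ∧
      ∀ s ∈ C, ∀ t ∈ C, ∀ v, v ∈ α s → v ∈ α t → s = t := by
  have hinj : Function.Injective c := fun i j hij => by
    by_contra hne
    exact hd i j hne (c i) (hmem i) (hij ▸ hmem j)
  have hr : Set.range c = C := by
    refine Set.eq_of_subset_of_ncard_le (Set.range_subset_iff.2 hc) ?_ (Set.toFinite _)
    rw [Set.ncard_range_of_injective hinj, hC, Nat.card_fin]
  have hα : ∀ s ∈ C, ∃ l, ∃ i, c i = s ∧ l = P i := by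
    rw [← hr]
    rintro _ ⟨i, rfl⟩
    exact ⟨P i, i, rfl, rfl⟩
  choose! α hα using hα
  refine ⟨α, hα, fun s hs t ht v hv hv' => ?_⟩
  obtain ⟨i, rfl, hi⟩ := hα s hs
  obtain ⟨j, rfl, hj⟩ := hα t ht
  by_contra hne
  have hvj : v ∈ P j := hj ▸ hv'
  exact hd i j (fun h => hne (congrArg c h)) v (hi ▸ hv) hvj

/-- A linking of size `q` into a set of size `q` is indexed by its endpoints. -/
theorem HasLinking.exists_index_right {V : Type*} [Finite V] {E : V → V → Prop} {A B : Set V}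
    {q : ℕ} (h : HasLinking E A B q) (hB : B.ncard = q) :
    ∃ α : V → List V, (∀ s ∈ B, (α s).Nodup ∧ ∃ a ∈ A, IsWalk E a s (α s)) ∧
      ∀ s ∈ B, ∀ t ∈ B, ∀ v, v ∈ α s → v ∈ α t → s = t := by
  obtain ⟨P, hP, hd⟩ := h
  choose hn a ha b hb hw using hP
  obtain ⟨α, hα, hαd⟩ := exists_index_of_disjoint hB hd hb
    fun i => List.mem_of_getLast? (hw i).2.2
  refine ⟨α, fun s hs => ?_, hαd⟩
  obtain ⟨i, rfl, hi⟩ := hα s hs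
  exact hi ▸ ⟨hn i, a i, ha i, hw i⟩

/-- A linking of size `q` out of a set of size `q` is indexed by its starting points. -/
theorem HasLinking.exists_index_left {V : Type*} [Finite V] {E : V → V → Prop} {A B : Set V}
    {q : ℕ} (h : HasLinking E A B q) (hA : A.ncard = q) :
    ∃ β : V → List V, (∀ s ∈ A, (β s).Nodup ∧ ∃ b ∈ B, IsWalk E s b (β s)) ∧
      ∀ s ∈ A, ∀ t ∈ A, ∀ v, v ∈ β s → v ∈ β t → s = t := by
  obtain ⟨P, hP, hd⟩ := h
  choose hn a ha b hb hw using hP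
  obtain ⟨β, hβ, hβd⟩ := exists_index_of_disjoint hA hd ha
    fun i => List.mem_of_head? (hw i).2.1
  refine ⟨β, fun s hs => ?_, hβd⟩
  obtain ⟨i, rfl, hi⟩ := hβ s hs
  exact hi ▸ ⟨hn i, b i, hb i, hw i⟩

/-- A family of disjoint simple paths indexed by a set with at least `q` elements
contains a linking of size `q`. -/
theorem hasLinking_of_indexed {V : Type*} [Finite V] {E : V → V → Prop} {A B I : Set V} {q : ℕ}
    (hI : q ≤ I.ncard) (γ : V → List V)
    (hγ : ∀ s ∈ I, (γ s).Nodup ∧ ∃ a ∈ A, ∃ b ∈ B, IsWalk E a b (γ s))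
    (hd : ∀ s ∈ I, ∀ t ∈ I, ∀ v, v ∈ γ s → v ∈ γ t → s = t) : HasLinking E A B q := by
  let e : Fin I.ncard ≃ I := (Finite.equivFinOfCardEq rfl).symm
  let f : Fin q → I := fun i => e (Fin.castLE hI i)
  have hf : Function.Injective f := e.injective.comp (Fin.castLE_injective hI)
  refine ⟨fun i => γ (f i), fun i => hγ _ (f i).2, fun i j hij v hv hv' => hij (hf ?_)⟩
  exact Subtype.ext (hd _ (f i).2 _ (f j).2 v hv hv')

theorem separatesSets_insert_left {V : Type*} {E : V → V → Prop} {A B S : Set V} {x y : V}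
    (h : SeparatesSets (EraseEdge E x y) A B S) : SeparatesSets E A B (insert x S) := by
  intro a ha b hb P hP
  rcases isChain_eraseEdge_or (x := x) (y := y) hP.1 with hc | hm
  · obtain ⟨s, hs, hsP⟩ := h a ha b hb P ⟨hc, hP.2⟩
    exact ⟨s, Or.inr hs, hsP⟩
  · exact ⟨x, Or.inl rfl, hm.1⟩

theorem separatesSets_insert_right {V : Type*} {E : V → V → Prop} {A B S : Set V} {x y : V}
    (h : SeparatesSets (EraseEdge E x y) A B S) : SeparatesSets E A B (insert y S) := by
  intro a ha b hb P hP
  rcases isChain_eraseEdge_or (x := x) (y := y) hP.1 with hc | hm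
  · obtain ⟨s, hs, hsP⟩ := h a ha b hb P ⟨hc, hP.2⟩
    exact ⟨s, Or.inr hs, hsP⟩
  · exact ⟨y, Or.inl rfl, hm.2⟩

theorem SeparatesSets.trans_left {V : Type*} {E : V → V → Prop} {A B P T : Set V} {x y : V}
    (hP : SeparatesSets E A B P) (hx : x ∈ P)
    (hT : SeparatesSets (EraseEdge E x y) A P T) : SeparatesSets E A B T := by
  intro a ha b hb W hW
  obtain ⟨s, hs, l₁, l₂, rfl, hl⟩ := exists_first_mem P (hP a ha b hb W hW)
  have hw := hW.initial_segment
  obtain ⟨t, ht, htl⟩ := hT a ha s hs _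
    ⟨isChain_eraseEdge_of_notMem_init hw.1 fun h => hl x h hx, hw.2⟩
  refine ⟨t, ht, ?_⟩
  simp only [List.mem_append, List.mem_cons, List.not_mem_nil, or_false] at htl ⊢
  tauto

theorem SeparatesSets.trans_right {V : Type*} {E : V → V → Prop} {A B Q T : Set V} {x y : V}
    (hQ : SeparatesSets E A B Q) (hy : y ∈ Q)
    (hT : SeparatesSets (EraseEdge E x y) Q B T) : SeparatesSets E A B T := by
  intro a ha b hb W hW
  obtain ⟨s, hs, l₁, l₂, rfl, hl⟩ := exists_last_mem Q (hQ a ha b hb W hW)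
  have hw := hW.final_segment
  obtain ⟨t, ht, htl⟩ := hT s hs b hb _
    ⟨isChain_eraseEdge_of_notMem_tail hw.1 fun h => hl y h hy, hw.2⟩
  exact ⟨t, ht, List.mem_append_right _ htl⟩

/-- Two linkings, one into `insert x S` and one out of `insert y S`, meet only in `S`
when `S` separates. -/
theorem mem_of_mem_linkings {V : Type*} {E : V → V → Prop} {A B S : Set V} {x y : V}
    (hS : SeparatesSets E A B S) {α β : V → List V}
    (hα : ∀ s ∈ insert x S, (α s).Nodup ∧ ∃ a ∈ A, IsWalk E a s (α s))
    (hαd : ∀ s ∈ insert x S, ∀ t ∈ insert x S, ∀ v, v ∈ α s → v ∈ α t → s = t)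
    (hβ : ∀ s ∈ insert y S, (β s).Nodup ∧ ∃ b ∈ B, IsWalk E s b (β s))
    (hβd : ∀ s ∈ insert y S, ∀ t ∈ insert y S, ∀ v, v ∈ β s → v ∈ β t → s = t)
    {s t v : V} (hs : s ∈ insert x S) (ht : t ∈ insert y S) (hvs : v ∈ α s) (hvt : v ∈ β t) :
    v ∈ S ∧ v = s ∧ v = t := by
  obtain ⟨hn, a, ha, hw⟩ := hα s hs
  obtain ⟨hn', b, hb, hw'⟩ := hβ t ht
  have hends : ∀ z ∈ S, (z ∈ α s → z = s) ∧ (z ∈ β t → z = t) := fun z hz =>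
    ⟨hαd z (.inr hz) s hs z (List.mem_of_getLast? (hα z (.inr hz)).2.choose_spec.2.2.2),
     hβd z (.inr hz) t ht z (List.mem_of_head? (hβ z (.inr hz)).2.choose_spec.2.2.1)⟩
  suffices hv : v ∈ S from ⟨hv, (hends v hv).1 hvs, (hends v hv).2 hvt⟩
  obtain ⟨l₁, l₂, h₁⟩ := List.append_of_mem hvs
  obtain ⟨l₃, l₄, h₂⟩ := List.append_of_mem hvt
  rw [h₁] at hw hn
  rw [h₂] at hw' hn'
  obtain ⟨z, hz, hzm⟩ := hS a ha b hb _ (hw.initial_segment.glue hw'.final_segment)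
  rw [List.mem_append, List.mem_cons] at hzm
  have hlast : s ∈ v :: l₂ := List.mem_of_getLast? hw.final_segment.2.2
  have hfirst : t ∈ l₃ ++ [v] := List.mem_of_head? hw'.initial_segment.2.1
  rcases hzm with hzm | rfl | hzm
  · have : z = s := (hends z hz).1 (h₁ ▸ List.mem_append_left _ hzm)
    subst this
    exact absurd rfl ((List.nodup_append.1 hn).2.2 z hzm z hlast)
  · exact hz
  · have : z = t := (hends z hz).2 (h₂ ▸ List.mem_append_right _ (List.mem_cons_of_mem _ hzm))
    subst this
    rw [List.append_cons] at hn'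
    exact absurd rfl ((List.nodup_append.1 hn').2.2 z hfirst z hzm)

/-- **Menger's theorem** for a finite digraph, set version: if every set meeting all walks
from `A` to `B` has at least `k` elements, there are `k` disjoint simple paths
from `A` to `B`. -/
theorem hasLinking_of_forall_separatesSets {V : Type*} [Finite V] (E : V → V → Prop)
    (A B : Set V) (k : ℕ) (h : ∀ S, SeparatesSets E A B S → k ≤ S.ncard) :
    HasLinking E A B k := by
  induction hN : {e : V × V | E e.1 e.2}.ncard using Nat.strong_induction_on
    generalizing E A B with
  | _ N ih =>
  by_cases hE : ∃ x y, E x y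
  · obtain ⟨x, y, hxy⟩ := hE
    have hlt : {e : V × V | EraseEdge E x y e.1 e.2}.ncard < N := by
      rw [← hN]
      refine Set.ncard_lt_ncard ⟨fun e he => he.1, fun hsub => ?_⟩ (Set.toFinite _)
      exact (hsub (a := (x, y)) hxy).2 ⟨rfl, rfl⟩
    by_cases hall : ∀ S, SeparatesSets (EraseEdge E x y) A B S → k ≤ S.ncard
    · exact (ih _ hlt _ A B hall rfl).mono fun _ _ he => he.1
    push Not at hall
    obtain ⟨S, hS, hSk⟩ := hall
    have hP := separatesSets_insert_left hS
    have hQ := separatesSets_insert_right hS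
    have hPk : (insert x S).ncard = k :=
      le_antisymm ((Set.ncard_insert_le x S).trans hSk) (h _ hP)
    have hQk : (insert y S).ncard = k :=
      le_antisymm ((Set.ncard_insert_le y S).trans hSk) (h _ hQ)
    have hyS : y ∉ S := fun hy => by
      rw [Set.insert_eq_of_mem hy] at hQk
      omega
    obtain ⟨α, hα, hαd⟩ := (ih _ hlt _ A (insert x S)
      (fun T hT => h T (hP.trans_left (.inl rfl) hT)) rfl).exists_index_right hPk
    obtain ⟨β, hβ, hβd⟩ := (ih _ hlt _ (insert y S) B
      (fun T hT => h T (hQ.trans_right (.inl rfl) hT)) rfl).exists_index_left hQk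
    have hmeet := @mem_of_mem_linkings _ _ _ _ _ _ _ hS α β hα hαd hβ hβd
    have hmono : ∀ u v, EraseEdge E x y u v → E u v := fun _ _ he => he.1
    classical
    have hγ : ∀ s ∈ insert x S, ∃ γ : List V, (γ.Nodup ∧ ∃ a ∈ A, ∃ b ∈ B, IsWalk E a b γ) ∧
        ∀ v ∈ γ, v ∈ α s ∨ v ∈ β (if s = x then y else s) := by
      intro s hs
      obtain ⟨hn, a, ha, hw⟩ := hα s hs
      by_cases hsx : s = x
      · subst hsx
        obtain ⟨hn', b, hb, hw'⟩ := hβ y (.inl rfl)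
        refine ⟨α s ++ β y, ⟨List.nodup_append.2 ⟨hn, hn', ?_⟩, a, ha, b, hb,
          (hw.mono hmono).append (hw'.mono hmono) hxy⟩, by simp⟩
        rintro u hu _ hu' rfl
        obtain ⟨h₁, -, h₂⟩ := hmeet hs (.inl rfl) hu hu'
        exact hyS (h₂ ▸ h₁)
      · have hsS : s ∈ S := hs.resolve_left hsx
        obtain ⟨hn', b, hb, hw'⟩ := hβ s (.inr hsS)
        obtain ⟨l, hl⟩ := List.getLast?_eq_some_iff.1 hw.2.2
        obtain ⟨l', hl'⟩ := List.head?_eq_some_iff.1 hw'.2.1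
        refine ⟨l ++ s :: l', ⟨?_, a, ha, b, hb,
          ((hl ▸ hw).glue (hl' ▸ hw')).mono hmono⟩, ?_⟩
        · refine List.nodup_append.2 ⟨(List.nodup_append.1 (hl ▸ hn)).1, hl' ▸ hn', ?_⟩
          rintro u hu _ hu' rfl
          obtain ⟨-, h₂, -⟩ := hmeet hs (.inr hsS) (hl ▸ List.mem_append_left _ hu)
            (hl'.symm ▸ hu')
          exact (List.nodup_append.1 (hl ▸ hn)).2.2 u hu s (by simp) h₂
        · intro v hv
          rw [if_neg hsx, hl, hl']
          rcases List.mem_append.1 hv with hv | hv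
          · exact .inl (List.mem_append_left _ hv)
          · exact .inr hv
    choose! γ hγ hγm using hγ
    refine hasLinking_of_indexed hPk.ge γ hγ fun s hs t ht v hv hv' => ?_
    have hτ : ∀ s ∈ insert x S, (if s = x then y else s) ∈ insert y S := by
      intro s hs
      split_ifs with hsx
      · exact .inl rfl
      · exact .inr (hs.resolve_left hsx)
    have hcross : ∀ s ∈ insert x S, ∀ t ∈ insert x S, v ∈ α s →
        v ∈ β (if t = x then y else t) → s = t := by
      intro s hs t ht hvs hvt
      obtain ⟨h₁, h₂, h₃⟩ := hmeet hs (hτ t ht) hvs hvt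
      split_ifs at h₃ with htx
      · exact absurd (h₃ ▸ h₁) hyS
      · exact h₂.symm.trans h₃
    rcases hγm s hs v hv with h₁ | h₁ <;> rcases hγm t ht v hv' with h₂ | h₂
    · exact hαd s hs t ht v h₁ h₂
    · exact hcross s hs t ht h₁ h₂
    · exact (hcross t ht s hs h₂ h₁).symm
    · have := hβd _ (hτ s hs) _ (hτ t ht) v h₁ h₂
      split_ifs at this with hsx htx htx
      · exact hsx.trans htx.symm
      · exact absurd (this ▸ ht.resolve_left htx) hyS
      · exact absurd (this ▸ hs.resolve_left hsx) hyS
      · exact this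
  · push Not at hE
    refine hasLinking_of_indexed (I := A ∩ B) (h _ ?_) (fun s => [s]) ?_ ?_
    · rintro a ha b hb P ⟨hc, hh, hl⟩
      match P, hc with
      | [], _ => simp at hh
      | [c], _ =>
        simp only [List.head?_cons, Option.some.injEq, List.getLast?_singleton] at hh hl
        exact ⟨c, ⟨hh ▸ ha, hl ▸ hb⟩, by simp⟩
      | c :: d :: l, hc => exact absurd (List.isChain_cons_cons.1 hc).1 (hE c d)
    · exact fun s hs => ⟨by simp, s, hs.1, s, hs.2, .singleton E s⟩
    · simp_all

/-- Every separator has at least as many elements as any family of internally disjoint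
paths. -/
theorem HasInternallyDisjoint.le_ncard {V : Type*} [Finite V] {E : V → V → Prop} {a b : V}
    {q : ℕ} (h : HasInternallyDisjoint E a b q) {S : Set V} (hS : IsSeparator E a b S) :
    q ≤ S.ncard := by
  obtain ⟨P, hP, hd⟩ := h
  obtain ⟨ha, hb, hS⟩ := hS
  choose s hs hsP using fun i => hS (P i) (hP i).2
  have hinj : Function.Injective s := fun i j hij => by
    by_contra hne
    rcases hd i j hne (s i) (hsP i) (hij ▸ hsP j) with h | h
    · exact ha (h ▸ hs i)
    · exact hb (h ▸ hs i)
  calc q = (Set.range s).ncard := by rw [Set.ncard_range_of_injective hinj, Nat.card_fin]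
    _ ≤ S.ncard := Set.ncard_le_ncard (Set.range_subset_iff.2 hs) (Set.toFinite _)

/-- A walk to `o` in the augmented graph contains a walk of `G` to an observer. -/
theorem exists_isWalk_observer_of_augE {n m : ℕ} (G : DCS n m) {a : Fin n ⊕ Fin m}
    {P : List ((Fin n ⊕ Fin m) ⊕ Unit)} (h : IsWalk (augE G) (Sum.inl a) (Sum.inr ()) P) :
    ∃ (j : Fin m) (l : List (Fin n ⊕ Fin m)), IsWalk G.E a (Sum.inr j) l ∧
      ∀ v ∈ l, Sum.inl v ∈ P := by
  induction P generalizing a with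
  | nil => simp [IsWalk] at h
  | cons c P ih =>
    obtain ⟨hc, hh, hl⟩ := h
    obtain rfl : c = Sum.inl a := by simpa using hh
    match P, hc with
    | [], _ => simp at hl
    | Sum.inr () :: Q, hc =>
      have he := (List.isChain_cons_cons.1 hc).1
      match a, he with
      | Sum.inr j, _ => exact ⟨j, [Sum.inr j], .singleton _ _, by simp⟩
    | Sum.inl d :: Q, hc =>
      obtain ⟨he, hc⟩ := List.isChain_cons_cons.1 hc
      obtain ⟨j, l, hw, hm⟩ := ih (a := d) ⟨hc, rfl, by simpa using hl⟩
      refine ⟨j, a :: l, ?_, ?_⟩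
      · exact (IsWalk.singleton G.E a).append hw he
      · intro v hv
        rcases List.mem_cons.1 hv with rfl | hv
        · simp
        · exact List.mem_cons_of_mem _ (hm v hv)

/-- A linking of `G` from `F` to the observers extends to internally disjoint paths from
`u` to `o`. -/
theorem hasInternallyDisjoint_starE {n m p : ℕ} (G : DCS n m) (F : Set (Fin n ⊕ Fin m))
    (h : HasLinking G.E F (Set.range Sum.inr) p) :
    HasInternallyDisjoint (starE G F) (Sum.inr ()) (Sum.inl (Sum.inr ())) p := by
  obtain ⟨P, hP, hd⟩ := h
  let ι : Fin n ⊕ Fin m → ((Fin n ⊕ Fin m) ⊕ Unit) ⊕ Unit := fun v => Sum.inl (Sum.inl v)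
  have hι : Function.Injective ι := Sum.inl_injective.comp Sum.inl_injective
  refine ⟨fun i => Sum.inr () :: ((P i).map ι ++ [Sum.inl (Sum.inr ())]), fun i => ⟨?_, ?_⟩, ?_⟩
  · simp [List.nodup_append, (hP i).1.map hι, ι]
  · obtain ⟨-, a, ha, _, ⟨j, rfl⟩, hc, hh, hl⟩ := hP i
    have hw : IsWalk (starE G F) (ι a) (ι (Sum.inr j)) ((P i).map ι) := by
      refine ⟨(List.isChain_map ι).2 hc, ?_, ?_⟩
      · simp [hh]
      · simp [hl]
    refine (IsWalk.singleton _ _).append (hw.append (IsWalk.singleton _ _) ?_) ?_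
    · exact trivial
    · exact ha
  · intro i j hij v hv hv'
    simp only [List.mem_cons, List.mem_append, List.mem_map, List.not_mem_nil, or_false] at hv hv'
    rcases hv with h | ⟨w, hw, rfl⟩ | h
    · exact .inl h
    · rcases hv' with h | ⟨w', hw', h⟩ | h
      · exact .inl h
      · exact absurd (hι h ▸ hw') (hd i j hij w hw)
      · exact .inr h
    · exact .inr h

/-- If every vertex separator of any `(x, o)` in the augmented graph `G′` has cardinality
at least `p`, then for any attack set `F ⊆ X ∪ Y` with `|F| = p`, in the graph `G*`
(obtained from `G′` by adding a vertex `u` with an edge to every element of `F`)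
every vertex separator of `(u, o)` has cardinality at least `p`; equivalently, `G*`
contains `p` internally disjoint simple paths from `u` to `o`. -/
theorem separator_ge_p_in_star {n m p : ℕ}
    (hp : 1 ≤ p) (hpm : p ≤ m) (hmn : m ≤ n) (G : DCS n m)
    (hrob : ∀ (x : Fin n) (S : Set ((Fin n ⊕ Fin m) ⊕ Unit)),
      IsSeparator (augE G) (Sum.inl (Sum.inl x)) (Sum.inr ()) S → p ≤ S.ncard)
    (F : Set (Fin n ⊕ Fin m)) (hF : F.ncard = p) :
    (∀ S : Set ((((Fin n ⊕ Fin m) ⊕ Unit) ⊕ Unit)),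
      IsSeparator (starE G F) (Sum.inr ()) (Sum.inl (Sum.inr ())) S → p ≤ S.ncard) ∧
    HasInternallyDisjoint (starE G F) (Sum.inr ()) (Sum.inl (Sum.inr ())) p := by
  have hlink : HasLinking G.E F (Set.range Sum.inr) p := by
    refine hasLinking_of_forall_separatesSets G.E F _ p fun T hT => ?_
    by_contra! hlt
    obtain ⟨f, hfF, hfT⟩ := Set.exists_mem_notMem_of_ncard_lt_ncard (hlt.trans_eq hF.symm)
    rcases f with x | j
    · refine absurd (hrob x (Sum.inl '' T) ⟨by simpa using hfT, by simp, fun P hP => ?_⟩) ?_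
      · obtain ⟨j, l, hw, hm⟩ := exists_isWalk_observer_of_augE G hP
        obtain ⟨s, hs, hsl⟩ := hT _ hfF _ ⟨j, rfl⟩ l hw
        exact ⟨Sum.inl s, ⟨s, hs, rfl⟩, hm s hsl⟩
      · rw [Set.ncard_image_of_injective _ Sum.inl_injective]
        exact hlt.not_ge
    · obtain ⟨s, hs, hsl⟩ := hT _ hfF _ ⟨j, rfl⟩ _ (IsWalk.singleton _ _)
      exact hfT (List.mem_singleton.1 hsl ▸ hs)
  have hpaths := hasInternallyDisjoint_starE G F hlink
  exact ⟨fun S hS => hpaths.le_ncard hS, hpaths⟩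
end

section
/- Fix integers n ≥ m ≥ p ≥ 1. Over all DCS digraphs G on n agents and m observers (every agent with a self-loop, dedicated sensors) that satisfy the agents-only robustness condition — for every unobserved agent x ∈ X, every vertex separator of (x, o) in the collapsed graph G″ has cardinality at least p — the minimum possible number of edges among agents (edges in X × X, self-loops included) equals (n − m)p + n. -/
/-- The agents that `x` has an edge to, other than `x` itself. -/
def properOutNeighbors {n m : ℕ} (G : DCS n m) (x : Fin n) : Set (Fin n) :=
  {y | y ≠ x ∧ G.E (Sum.inl x) (Sum.inl y)}

theorem agentEdgeCount_eq_sum {n m : ℕ} (G : DCS n m) :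
    agentEdgeCount G = ∑ x, ((properOutNeighbors G x).ncard + 1) := by
  classical
  have h : ∀ x, (properOutNeighbors G x).ncard + 1 =
      Nat.card {y // G.E (Sum.inl x) (Sum.inl y)} := by
    intro x
    rw [← Set.ncard_insert_of_notMem (a := x) (by simp [properOutNeighbors])]
    change _ = {y | G.E (Sum.inl x) (Sum.inl y)}.ncard
    refine congrArg Set.ncard (Set.ext fun y => ?_)
    by_cases hy : y = x
    · simp [hy, G.selfLoop]
    · simp [hy, properOutNeighbors]
  simp_rw [h]
  rw [← Nat.card_sigma]
  exact Nat.card_congr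
    { toFun := fun e => ⟨e.1.1, e.1.2, e.2⟩
      invFun := fun e => ⟨(e.1, e.2.1), e.2.2⟩
      left_inv := fun _ => rfl
      right_inv := fun _ => rfl }

open Classical in
theorem sum_unobserved {n m : ℕ} (G : DCS n m) (p : ℕ) :
    ∑ x, ((if Observed G x then 0 else p) + 1) = (n - m) * p + n := by
  have hobs : (Finset.univ.filter fun x => Observed G x).card = m := by
    have : (Finset.univ.filter fun x => Observed G x) = Finset.univ.image G.obs := by
      ext x
      simp only [Finset.mem_filter_univ, Finset.mem_image, Finset.mem_univ, true_and]
      rfl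
    rw [this, Finset.card_image_of_injective _ G.obs_inj, Finset.card_fin]
  have hsum := Finset.card_filter_add_card_filter_not
    (s := (Finset.univ : Finset (Fin n))) (fun x => Observed G x)
  rw [hobs, Finset.card_fin] at hsum
  have hunobs : (Finset.univ.filter fun x => ¬ Observed G x).card = n - m := by omega
  rw [Finset.sum_add_distrib, Finset.sum_ite]
  simp [hunobs]

/-- The proper out-neighbours of an unobserved agent separate it from `o`. -/
theorem isSeparator_properOutNeighbors {n m : ℕ} (G : DCS n m) {x : Fin n}
    (hx : ¬ Observed G x) :
    IsSeparator (colE G) (Sum.inl x) (Sum.inr ()) (Sum.inl '' properOutNeighbors G x) := by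
  refine ⟨by simp [properOutNeighbors], by simp, fun P => ?_⟩
  induction P with
  | nil => simp [IsWalk]
  | cons a P ih =>
    rintro ⟨hc, hh, hl⟩
    obtain rfl : a = Sum.inl x := by simpa using hh
    cases P with
    | nil => simp at hl
    | cons b P =>
      obtain ⟨hab, hbP⟩ := List.isChain_cons_cons.1 hc
      rcases b with y | u
      · by_cases hy : y = x
        · subst hy
          obtain ⟨s, hs, hsP⟩ := ih ⟨hbP, rfl, by simpa using hl⟩
          exact ⟨s, hs, List.mem_cons_of_mem _ hsP⟩
        · exact ⟨Sum.inl y, ⟨y, ⟨hy, hab⟩, rfl⟩, by simp⟩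
      · exact absurd hab hx

theorem RobustX.le_ncard_properOutNeighbors {n m p : ℕ} {G : DCS n m} (hG : RobustX G p)
    {x : Fin n} (hx : ¬ Observed G x) : p ≤ (properOutNeighbors G x).ncard := by
  rw [← Set.ncard_image_of_injective _ (Sum.inl_injective (β := Unit))]
  exact hG x hx _ (isSeparator_properOutNeighbors G hx)

/-- The digraph in which agents `0, …, m - 1` are observed and, besides the self-loops, every
unobserved agent has an edge to each of the agents `0, …, p - 1`. -/
def extremalDCS {n m : ℕ} (p : ℕ) (hmn : m ≤ n) : DCS n m where
  E
    | Sum.inl x, Sum.inl y => x = y ∨ (m ≤ (x : ℕ) ∧ (y : ℕ) < p)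
    | Sum.inl x, Sum.inr j => x = Fin.castLE hmn j
    | Sum.inr _, _ => False
  obs := Fin.castLE hmn
  obs_inj := Fin.castLE_injective hmn
  selfLoop _ := Or.inl rfl
  obs_in _ _ := Iff.rfl
  obs_noOut _ _ := id

theorem observed_extremalDCS {n m p : ℕ} (hmn : m ≤ n) (x : Fin n) :
    Observed (extremalDCS p hmn) x ↔ (x : ℕ) < m :=
  ⟨fun ⟨j, hj⟩ => hj ▸ j.2, fun h => ⟨⟨x, h⟩, rfl⟩⟩

theorem ncard_fin_lt {n p : ℕ} (hpn : p ≤ n) : {y : Fin n | (y : ℕ) < p}.ncard = p := by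
  have : {y : Fin n | (y : ℕ) < p} = Set.range (Fin.castLE hpn) :=
    (Fin.range_castLE hpn).symm
  rw [this, ← Set.image_univ, Set.ncard_image_of_injective _ (Fin.castLE_injective hpn)]
  simp

open Classical in
theorem ncard_properOutNeighbors_extremalDCS {n m p : ℕ} (hpm : p ≤ m) (hmn : m ≤ n)
    (x : Fin n) : (properOutNeighbors (extremalDCS p hmn) x).ncard =
      if Observed (extremalDCS p hmn) x then 0 else p := by
  rw [observed_extremalDCS]
  split_ifs with hx
  · rw [Set.ncard_eq_zero]
    refine Set.eq_empty_of_forall_notMem ?_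
    rintro y ⟨hyx, rfl | ⟨h, -⟩⟩
    · exact hyx rfl
    · omega
  · refine Eq.trans ?_ (ncard_fin_lt (hpm.trans hmn))
    refine congrArg Set.ncard (Set.ext fun y => ⟨?_, fun hy => ⟨?_, Or.inr ⟨by omega, hy⟩⟩⟩)
    · rintro ⟨hyx, rfl | ⟨-, h⟩⟩
      · exact absurd rfl hyx
      · exact h
    · rintro rfl
      exact hx (lt_of_lt_of_le hy hpm)

theorem robustX_extremalDCS {n m p : ℕ} (hpm : p ≤ m) (hmn : m ≤ n) :
    RobustX (extremalDCS p hmn) p := by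
  rintro x hx S ⟨hxS, hoS, hS⟩
  rw [observed_extremalDCS, not_lt] at hx
  calc p = (Sum.inl '' {y : Fin n | (y : ℕ) < p} : Set (Fin n ⊕ Unit)).ncard := by
        rw [Set.ncard_image_of_injective _ Sum.inl_injective, ncard_fin_lt (hpm.trans hmn)]
    _ ≤ S.ncard := by
        refine Set.ncard_le_ncard ?_ S.toFinite
        rintro _ ⟨y, hy, rfl⟩
        have hxy : colE (extremalDCS p hmn) (Sum.inl x) (Sum.inl y) := Or.inr ⟨hx, hy⟩
        have hyo : colE (extremalDCS p hmn) (Sum.inl y) (Sum.inr ()) :=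
          (observed_extremalDCS hmn y).2 (lt_of_lt_of_le hy hpm)
        obtain ⟨s, hs, hsP⟩ := hS [Sum.inl x, Sum.inl y, Sum.inr ()]
          ⟨List.isChain_cons_cons.2 ⟨hxy, List.isChain_pair.2 hyo⟩, rfl, rfl⟩
        simp only [List.mem_cons, List.not_mem_nil, or_false] at hsP
        rcases hsP with rfl | rfl | rfl
        · exact absurd hs hxS
        · exact hs
        · exact absurd hs hoS

/-- Over all DCS digraphs on `n` agents and `m` observers that are robust to all
feasible agent-only attacks of size at most `p` (for every unobserved agent `x`, every
vertex separator of `(x, o)` in the collapsed graph `G″` has cardinality at least `p`),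
the minimum possible number of agent-to-agent edges (self-loops included) equals
`(n - m)p + n`. -/
theorem min_edges_robustX {n m p : ℕ} (hp : 1 ≤ p) (hpm : p ≤ m) (hmn : m ≤ n) :
    IsLeast {k : ℕ | ∃ G : DCS n m, RobustX G p ∧ agentEdgeCount G = k}
      ((n - m) * p + n) := by
  classical
  constructor
  · refine ⟨extremalDCS p hmn, robustX_extremalDCS hpm hmn, ?_⟩
    simp_rw [agentEdgeCount_eq_sum, ncard_properOutNeighbors_extremalDCS hpm hmn]
    exact sum_unobserved _ p
  · rintro _ ⟨G, hG, rfl⟩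
    rw [agentEdgeCount_eq_sum, ← sum_unobserved G p]
    refine Finset.sum_le_sum fun x _ => Nat.add_le_add_right ?_ 1
    split_ifs with hx
    · exact Nat.zero_le _
    · exact hG.le_ncard_properOutNeighbors hx
end
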